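/- arXiv:1811.01696 — 2 statements merged into one kernel-verified Lean document; each statement's English description precedes it below -/
import Mathlib

section
/- Let A be an n×n real symmetric matrix with exactly one positive eigenvalue (counted with multiplicity), and let u ∈ ℝ^n satisfy uᵀAu > 0. Then A is negative semidefinite on the hyperplane {v ∈ ℝ^n : uᵀAv = 0}; that is, vᵀAv ≤ 0 for every v ∈ ℝ^n with uᵀAv = 0. -/
open Matrix

/-- The bilinear form of a real symmetric matrix, in coordinates with respect to an orthonormal
basis of eigenvectors. -/
theorem Matrix.IsHermitian.dotProduct_mulVec_eq_sum_eigenvalues {ι : Type*} [Fintype ι]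
    [DecidableEq ι] {A : Matrix ι ι ℝ} (hA : A.IsHermitian) (x y : ι → ℝ) :
    x ⬝ᵥ A *ᵥ y = ∑ i, hA.eigenvalues i *
      ((x ᵥ* (hA.eigenvectorUnitary : Matrix ι ι ℝ)) i *
        (y ᵥ* (hA.eigenvectorUnitary : Matrix ι ι ℝ)) i) := by
  conv_lhs => rw [hA.spectral_theorem, Unitary.conjStarAlgAut_apply]
  rw [← mulVec_mulVec, ← mulVec_mulVec, dotProduct_mulVec, star_eq_conjTranspose,
    conjTranspose_eq_transpose_of_trivial, mulVec_transpose]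
  simp only [dotProduct, mulVec_diagonal, Function.comp_apply, RCLike.ofReal_real_eq_id, id_eq]
  exact Finset.sum_congr rfl fun i _ => by ring

/-- If `k` is the only index of a positive eigenvalue, the quadratic form is nonpositive on vectors
whose `k`-th coordinate in the eigenvector basis vanishes. -/
theorem Matrix.IsHermitian.dotProduct_mulVec_nonpos {ι : Type*} [Fintype ι] [DecidableEq ι]
    {A : Matrix ι ι ℝ} (hA : A.IsHermitian) {k : ι} (hk : ∀ i, i ≠ k → hA.eigenvalues i ≤ 0)
    {x : ι → ℝ} (hx : (x ᵥ* (hA.eigenvectorUnitary : Matrix ι ι ℝ)) k = 0) :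
    x ⬝ᵥ A *ᵥ x ≤ 0 := by
  rw [hA.dotProduct_mulVec_eq_sum_eigenvalues]
  refine Finset.sum_nonpos fun i _ => ?_
  rcases eq_or_ne i k with rfl | hi
  · simp [hx]
  · exact mul_nonpos_of_nonpos_of_nonneg (hk i hi) (mul_self_nonneg _)

theorem statement4 (n : ℕ) (A : Matrix (Fin n) (Fin n) ℝ) (hA : A.IsHermitian)
    (h1 : Fintype.card {i // 0 < hA.eigenvalues i} = 1)
    (u : Fin n → ℝ) (hu : 0 < u ⬝ᵥ A.mulVec u)
    (v : Fin n → ℝ) (hv : u ⬝ᵥ A.mulVec v = 0) :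
    v ⬝ᵥ A.mulVec v ≤ 0 := by
  obtain ⟨⟨k, _⟩, hk⟩ := Fintype.card_eq_one_iff.mp h1
  have hk' : ∀ i, i ≠ k → hA.eigenvalues i ≤ 0 := fun i hi =>
    not_lt.mp fun h => hi (congrArg Subtype.val (hk ⟨i, h⟩))
  have hvu : v ⬝ᵥ A *ᵥ u = 0 := by
    rw [← hv, hA.dotProduct_mulVec_eq_sum_eigenvalues, hA.dotProduct_mulVec_eq_sum_eigenvalues]
    exact Finset.sum_congr rfl fun i _ => by ring
  set a := (v ᵥ* (hA.eigenvectorUnitary : Matrix (Fin n) (Fin n) ℝ)) k with ha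
  set b := (u ᵥ* (hA.eigenvectorUnitary : Matrix (Fin n) (Fin n) ℝ)) k with hb
  have hb0 : b ≠ 0 := fun h => hu.not_ge (hA.dotProduct_mulVec_nonpos hk' h)
  have hw := hA.dotProduct_mulVec_nonpos hk' (x := a • u - b • v) (by
    simp only [sub_vecMul, smul_vecMul, Pi.sub_apply, Pi.smul_apply, smul_eq_mul, ← ha, ← hb]
    ring)
  simp only [mulVec_sub, mulVec_smul, sub_dotProduct, dotProduct_sub, smul_dotProduct,
    dotProduct_smul, smul_eq_mul, hv, hvu] at hw
  have hb2 : 0 < b ^ 2 := by positivity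
  refine nonpos_of_mul_nonpos_right ?_ hb2
  nlinarith [mul_nonneg (sq_nonneg a) hu.le]
end

section
/- Let n ≥ 2, let M be a matroid on [n], let 0 < q ≤ 1, and let 0 < t < 1. Then for all nonzero w = (w_1,…,w_n) ∈ ℝ^n, Z^1_M(q, w)² > 2t·(n/(n−1))·Z^2_M(q, w). -/
open MvPolynomial Finset

/-- Rank-function axioms for a matroid on `[n]` (Oxley, Theorem 1.3.2). -/
def IsMatroidRank (n : ℕ) (rk : Finset (Fin n) → ℕ) : Prop :=
  (∀ A, rk A ≤ A.card) ∧
  (∀ A B, A ⊆ B → rk A ≤ rk B) ∧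
  (∀ A B : Finset (Fin n), rk (A ∪ B) + rk (A ∩ B) ≤ rk A + rk B)

/-- `Z^k_M(q, w)`. -/
noncomputable def Zk (n : ℕ) (q : ℝ) (rk : Finset (Fin n) → ℕ) (k : ℕ) :
    MvPolynomial (Fin n) ℝ :=
  ∑ A ∈ Finset.powersetCard k (Finset.univ : Finset (Fin n)),
    C (q ^ (-(rk A : ℤ))) * ∏ i ∈ A, X i

/-- Cauchy–Schwarz over the fibres of a self-map. -/
theorem sq_sum_le_card_mul_sum_fiber {n : ℕ} (f : Fin n → Fin n) (y : Fin n → ℝ) :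
    (∑ i, y i) ^ 2 ≤ n * ∑ i, ∑ j, if f i = f j then y i * y j else 0 := by
  have hfib : ∑ c, ∑ i with f i = c, y i = ∑ i, y i :=
    Finset.sum_fiberwise_of_maps_to (fun _ _ => Finset.mem_univ _) y
  have hsq : ∑ c, (∑ i with f i = c, y i) ^ 2 =
      ∑ i, ∑ j, if f i = f j then y i * y j else 0 := by
    simp_rw [Finset.sum_filter, sq, Finset.sum_mul_sum]
    rw [Finset.sum_comm]
    refine Finset.sum_congr rfl fun i _ => ?_
    rw [Finset.sum_comm]
    refine Finset.sum_congr rfl fun j _ => ?_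
    rw [Finset.sum_eq_single (f i)]
    · simp [eq_comm]
    · intro c _ hc
      simp [hc.symm]
    · simp
  have h := sq_sum_le_card_mul_sum_sq (s := (Finset.univ : Finset (Fin n)))
    (f := fun c => ∑ i with f i = c, y i)
  rw [hfib, hsq] at h
  simpa using h

theorem sum_offDiag_pair_eq_two_mul {α : Type*} [Fintype α] [DecidableEq α] (g : Finset α → ℝ) :
    ∑ p ∈ (Finset.univ : Finset α).offDiag, g {p.1, p.2} =
      2 * ∑ A ∈ Finset.powersetCard 2 (Finset.univ : Finset α), g A := by
  rw [← Finset.sum_fiberwise_of_maps_to (g := fun p : α × α => ({p.1, p.2} : Finset α))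
    (t := Finset.powersetCard 2 (Finset.univ : Finset α)), Finset.mul_sum]
  · refine Finset.sum_congr rfl fun A hA => ?_
    obtain ⟨a, b, hab, rfl⟩ := Finset.card_eq_two.1 (Finset.mem_powersetCard.1 hA).2
    have hfib : {p ∈ (Finset.univ : Finset α).offDiag | ({p.1, p.2} : Finset α) = {a, b}} =
        {(a, b), (b, a)} := by
      ext ⟨x, y⟩
      simp only [Finset.mem_filter, Finset.mem_offDiag, Finset.mem_univ, true_and,
        Finset.mem_insert, Finset.mem_singleton, Prod.mk.injEq]
      constructor
      · rintro ⟨hxy, h⟩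
        have hx : x ∈ ({a, b} : Finset α) := h ▸ by simp
        have hy : y ∈ ({a, b} : Finset α) := h ▸ by simp
        simp only [Finset.mem_insert, Finset.mem_singleton] at hx hy
        grind
      · rintro (⟨rfl, rfl⟩ | ⟨rfl, rfl⟩)
        · exact ⟨hab, rfl⟩
        · exact ⟨hab.symm, Finset.pair_comm _ _⟩
    rw [hfib, Finset.sum_pair (by simp [hab])]
    simp only [Finset.pair_comm b a]
    ring
  · rintro ⟨x, y⟩ h
    simp only [Finset.mem_offDiag, Finset.mem_univ, true_and] at h
    simp [Finset.mem_powersetCard, Finset.card_pair h]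

namespace IsMatroidRank

variable {n : ℕ} {rk : Finset (Fin n) → ℕ}

theorem le_pair_left (hrk : IsMatroidRank n rk) (i j : Fin n) : rk {i} ≤ rk {i, j} :=
  hrk.2.1 _ _ (by simp)

theorem le_pair_right (hrk : IsMatroidRank n rk) (i j : Fin n) : rk {j} ≤ rk {i, j} :=
  hrk.2.1 _ _ (by simp)

theorem pair_le_add (hrk : IsMatroidRank n rk) (i j : Fin n) : rk {i, j} ≤ rk {i} + rk {j} :=
  (Nat.le_add_right _ _).trans (hrk.2.2 {i} {j})

theorem singleton_le_one (hrk : IsMatroidRank n rk) (i : Fin n) : rk {i} ≤ 1 := by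
  simpa using hrk.1 {i}

/-- Two elements are related if they are equal or parallel non-loops. -/
def parallelSetoid (hrk : IsMatroidRank n rk) : Setoid (Fin n) where
  r i j := i = j ∨ rk {i} = 1 ∧ rk {j} = 1 ∧ rk {i, j} = 1
  iseqv :=
    { refl := fun _ => Or.inl rfl
      symm := by
        rintro i j (rfl | ⟨hi, hj, hij⟩)
        · exact Or.inl rfl
        · exact Or.inr ⟨hj, hi, by rwa [Finset.pair_comm]⟩
      trans := by
        rintro i j k (rfl | ⟨hi, hj, hij⟩) (rfl | ⟨_, hk, hjk⟩)
        · exact Or.inl rfl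
        · exact Or.inr ⟨by assumption, hk, hjk⟩
        · exact Or.inr ⟨hi, hj, hij⟩
        · have hsub := hrk.2.2 {i, j} {j, k}
          have hinter : rk {j} ≤ rk ({i, j} ∩ {j, k}) := hrk.2.1 _ _ (by simp)
          have hunion : rk {i, k} ≤ rk ({i, j} ∪ {j, k}) :=
            hrk.2.1 _ _ (by intro x; simp; tauto)
          have := hrk.le_pair_left i k
          exact Or.inr ⟨hi, hk, by omega⟩ }

/-- A representative of the parallel class of an element. -/
noncomputable def parallelRep (hrk : IsMatroidRank n rk) (i : Fin n) : Fin n :=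
  (Quotient.mk hrk.parallelSetoid i).out

theorem parallelRep_eq_iff (hrk : IsMatroidRank n rk) (i j : Fin n) :
    hrk.parallelRep i = hrk.parallelRep j ↔
      i = j ∨ rk {i} = 1 ∧ rk {j} = 1 ∧ rk {i, j} = 1 :=
  Quotient.out_inj.trans Quotient.eq

theorem zpow_neg_pair (hrk : IsMatroidRank n rk) {q : ℝ} (hq : q ≠ 0) {i j : Fin n}
    (hij : i ≠ j) :
    q ^ (-(rk {i, j} : ℤ)) = (if hrk.parallelRep i = hrk.parallelRep j then q else 1) *
      (q ^ (-(rk {i} : ℤ)) * q ^ (-(rk {j} : ℤ))) := by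
  have h1 := hrk.le_pair_left i j
  have h2 := hrk.le_pair_right i j
  have h3 := hrk.pair_le_add i j
  have h4 := hrk.singleton_le_one i
  have h5 := hrk.singleton_le_one j
  simp only [hrk.parallelRep_eq_iff, hij, false_or]
  split_ifs with h
  · obtain ⟨hi, hj, hp⟩ := h
    rw [hi, hj, hp]
    simp [hq]
  · rw [one_mul, ← zpow_add₀ hq]
    congr 1
    omega

end IsMatroidRank

theorem eval_Zk_one (n : ℕ) (q : ℝ) (rk : Finset (Fin n) → ℕ) (w : Fin n → ℝ) :
    eval w (Zk n q rk 1) = ∑ i, q ^ (-(rk {i} : ℤ)) * w i := by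
  simp [Zk, Finset.powersetCard_one]

theorem two_mul_eval_Zk_two {n : ℕ} {q : ℝ} (hq : q ≠ 0) {rk : Finset (Fin n) → ℕ}
    (hrk : IsMatroidRank n rk) (w y : Fin n → ℝ) (hy : ∀ i, y i = q ^ (-(rk {i} : ℤ)) * w i) :
    2 * eval w (Zk n q rk 2) = (∑ i, y i) ^ 2 - q * ∑ i, y i ^ 2 -
      (1 - q) * ∑ i, ∑ j,
        if hrk.parallelRep i = hrk.parallelRep j then y i * y j else 0 := by
  have hsum : 2 * eval w (Zk n q rk 2) =
      ∑ i, ∑ j, if i = j then 0 else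
        (if hrk.parallelRep i = hrk.parallelRep j then q else 1) * (y i * y j) := by
    simp only [Zk, map_sum, map_mul, map_prod, eval_C, eval_X]
    rw [← sum_offDiag_pair_eq_two_mul fun A => q ^ (-(rk A : ℤ)) * ∏ i ∈ A, w i,
      ← Finset.sum_product', Finset.univ_product_univ, ← Finset.sum_subset
        (Finset.subset_univ (Finset.univ : Finset (Fin n)).offDiag)]
    · refine Finset.sum_congr rfl ?_
      rintro ⟨i, j⟩ h
      simp only [Finset.mem_offDiag, Finset.mem_univ, true_and] at h
      simp only [if_neg h, Finset.prod_pair h, hrk.zpow_neg_pair hq h, hy]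
      ring
    · rintro ⟨i, j⟩ - h
      simp only [Finset.mem_offDiag, Finset.mem_univ, true_and, not_not] at h
      simp [h]
  have hdiag : ∑ i, y i ^ 2 = ∑ i, ∑ j, if i = j then y i * y j else 0 := by
    simp [sq]
  rw [hsum, hdiag, sq, Finset.sum_mul_sum]
  simp only [Finset.mul_sum, ← Finset.sum_sub_distrib]
  refine Finset.sum_congr rfl fun i _ => Finset.sum_congr rfl fun j _ => ?_
  rcases eq_or_ne i j with rfl | hij
  · simp only [if_true]
    ring
  · simp only [if_neg hij]
    split_ifs <;> ring

theorem statement6 (n : ℕ) (hn : 2 ≤ n) (rk : Finset (Fin n) → ℕ)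
    (hrk : IsMatroidRank n rk) (q : ℝ) (hq0 : 0 < q) (hq1 : q ≤ 1)
    (t : ℝ) (ht0 : 0 < t) (ht1 : t < 1)
    (w : Fin n → ℝ) (hw : w ≠ 0) :
    2 * t * ((n : ℝ) / ((n : ℝ) - 1)) * eval w (Zk n q rk 2) < (eval w (Zk n q rk 1)) ^ 2 := by
  have hn' : (2 : ℝ) ≤ n := by exact_mod_cast hn
  obtain ⟨y, hy⟩ : ∃ y : Fin n → ℝ, ∀ i, y i = q ^ (-(rk {i} : ℤ)) * w i := ⟨_, fun _ => rfl⟩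
  have hZ := two_mul_eval_Zk_two hq0.ne' hrk w y hy
  have hcs := sq_sum_le_card_mul_sum_fiber hrk.parallelRep y
  have hcs' : (∑ i, y i) ^ 2 ≤ n * ∑ i, y i ^ 2 := by
    simpa using sq_sum_le_card_mul_sum_sq (s := Finset.univ) (f := y)
  have hpos : 0 < ∑ i, y i ^ 2 := by
    obtain ⟨i, hi⟩ := Function.ne_iff.1 hw
    refine Finset.sum_pos' (fun _ _ => sq_nonneg _) ⟨i, Finset.mem_univ _, ?_⟩
    have : y i ≠ 0 := by
      rw [hy]
      exact mul_ne_zero (zpow_ne_zero _ hq0.ne') hi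
    positivity
  rw [eval_Zk_one]
  simp only [← hy]
  generalize eval w (Zk n q rk 2) = Z at *
  generalize (∑ i, ∑ j, if hrk.parallelRep i = hrk.parallelRep j then y i * y j else 0) = R at *
  generalize ∑ i, y i ^ 2 = Q at *
  generalize ∑ i, y i = S at *
  have hbound : n * (2 * Z) ≤ (n - 1) * S ^ 2 := by
    rw [hZ]
    have h1 := mul_le_mul_of_nonneg_left hcs' hq0.le
    have h2 := mul_le_mul_of_nonneg_left hcs (sub_nonneg.2 hq1)
    linarith
  have hR : 0 ≤ R := nonneg_of_mul_nonneg_right ((sq_nonneg S).trans hcs) (by linarith)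
  rw [show 2 * t * ((n : ℝ) / (n - 1)) * Z = t * (n * (2 * Z)) / (n - 1) by ring,
    div_lt_iff₀ (by linarith)]
  rcases le_or_gt Z 0 with hZ0 | hZ0
  · rcases eq_or_ne S 0 with rfl | hS
    · have hneg : 2 * Z < 0 := by
        have h1 := mul_pos hq0 hpos
        have h2 := mul_nonneg (sub_nonneg.2 hq1) hR
        linarith
      have := mul_pos (mul_pos ht0 (by linarith : (0 : ℝ) < n)) (neg_pos.2 hneg)
      linarith
    · have h1 : 0 < S ^ 2 * ((n : ℝ) - 1) := mul_pos (by positivity) (by linarith)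
      have h2 := mul_nonneg (mul_nonneg ht0.le (by linarith : (0 : ℝ) ≤ n)) (neg_nonneg.2 hZ0)
      linarith
  · have h1 : 0 < (1 - t) * (n * (2 * Z)) :=
      mul_pos (by linarith) (mul_pos (by linarith) (by linarith))
    linarith
end
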